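/- Single-succedent version of the main theorem: for any set C of connectives, FOILS₁(C) = FOCDS₁(C) if and only if every connective in C is supermultiplicative, where FOILS₁(C) (respectively FOCDS₁(C)) is the set of sequents Γ ⇒ Δ over C with Δ consisting of a single formula that are valid in all Kripke models (respectively in all constant domain Kripke models). -/

import Mathlib

open Classical

open Classical

/-- A signature: a set of propositional connectives, each with an arity and a
truth function `{0,1}^arity → {0,1}` (represented with `Bool`). -/
structure Signature : Type 1 where
  Conn : Type
  arity : Conn → ℕ
  tt : (c : Conn) → (Fin (arity c) → Bool) → Bool

/-- Predicate symbols: for each pair `(k, n)` a predicate symbol of arity `n`. -/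
abbrev PredSym : Type := ℕ × ℕ

/-- The arity of a predicate symbol. -/
abbrev parity (p : PredSym) : ℕ := p.2

/-- Predicate formulas over a signature: atomic formulas `p(x₁,…,xₙ)` (with
individual variables drawn from `ℕ`), applications of connectives, and the
quantifiers `∀x`, `∃x`. -/
inductive Formula (sig : Signature) : Type where
  | atom (p : PredSym) (args : Fin (parity p) → ℕ)
  | conn (c : sig.Conn) (args : Fin (sig.arity c) → Formula sig)
  | all (x : ℕ) (φ : Formula sig)
  | ex (x : ℕ) (φ : Formula sig)

/-- A Kripke model with worlds `W` and individuals drawn from `U`. -/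
structure Kripke (sig : Signature) (W U : Type) : Type where
  le : W → W → Prop
  le_refl : ∀ w, le w w
  le_trans : ∀ {w v u}, le w v → le v u → le w u
  D : W → Set U
  D_nonempty : ∀ w, (D w).Nonempty
  D_mono : ∀ {w v}, le w v → D w ⊆ D v
  I : (w : W) → (p : PredSym) → (Fin (parity p) → U) → Bool
  hered : ∀ {w v}, le w v → ∀ (p : PredSym) (a : Fin (parity p) → U),
      (∀ i, a i ∈ D w) → I w p a ≤ I v p a

/-- The value `‖φ‖_{K,w}^ρ ∈ {0,1}` of a formula at a world under an assignment. -/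
noncomputable def val {sig : Signature} {W U : Type} (K : Kripke sig W U) :
    Formula sig → W → (ℕ → U) → Bool
  | .atom p args, w, ρ => K.I w p (fun i => ρ (args i))
  | .conn c args, w, ρ =>
      decide (∀ v, K.le w v → sig.tt c (fun i => val K (args i) v ρ) = true)
  | .all x φ, w, ρ =>
      decide (∀ v, K.le w v → ∀ a ∈ K.D v, val K φ v (Function.update ρ x a) = true)
  | .ex x φ, w, ρ =>
      decide (∃ a ∈ K.D w, val K φ w (Function.update ρ x a) = true)

/-- A sequent `Γ ⇒ Δ` (two sets of formulas) is valid in a Kripke model if at no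
world and assignment do all formulas of `Γ` get value 1 and all formulas of `Δ`
get value 0. -/
def SeqValid {sig : Signature} {W U : Type} (K : Kripke sig W U)
    (Γ Δ : Set (Formula sig)) : Prop :=
  ∀ (w : W) (ρ : ℕ → U), (∀ x, ρ x ∈ K.D w) →
    ¬ ((∀ φ ∈ Γ, val K φ w ρ = true) ∧ (∀ φ ∈ Δ, val K φ w ρ = false))

/-- A Kripke model has constant domains if all worlds have the same domain. -/
def ConstantDomain {sig : Signature} {W U : Type} (K : Kripke sig W U) : Prop :=
  ∀ w v, K.D w = K.D v

/-- `Γ ⇒ Δ` is Kripke-valid (belongs to FOILS). -/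
def FOILS (sig : Signature) (Γ Δ : Set (Formula sig)) : Prop :=
  ∀ (W U : Type) (K : Kripke sig W U), SeqValid K Γ Δ

/-- `Γ ⇒ Δ` is valid in all constant domain Kripke models (belongs to FOCDS). -/
def FOCDS (sig : Signature) (Γ Δ : Set (Formula sig)) : Prop :=
  ∀ (W U : Type) (K : Kripke sig W U), ConstantDomain K → SeqValid K Γ Δ

/-- `Γ ⇒ Δ` is valid in all one-world Kripke models, i.e. classically valid
(belongs to FOCLS). -/
def FOCLS (sig : Signature) (Γ Δ : Set (Formula sig)) : Prop :=
  ∀ (U : Type) (K : Kripke sig Unit U), SeqValid K Γ Δ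

/-- A truth function is supermultiplicative if `f(a) = f(b) = 1` implies
`f(a ⊓ b) = 1`, where `⊓` is the componentwise minimum. -/
def Supermultiplicative {n : ℕ} (f : (Fin n → Bool) → Bool) : Prop :=
  ∀ a b : Fin n → Bool, f a = true → f b = true → f (fun i => a i && b i) = true

/-- A truth function is monotonic if `a ⊑ b` (componentwise) implies `f a ≤ f b`. -/
def Monotonic {n : ℕ} (f : (Fin n → Bool) → Bool) : Prop :=
  ∀ a b : Fin n → Bool, (∀ i, a i ≤ b i) → f a ≤ f b

theorem val_mono {sig : Signature} {W U : Type} (K : Kripke sig W U) (φ : Formula sig) :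
    ∀ {w v : W} {ρ : ℕ → U}, K.le w v → (∀ x, ρ x ∈ K.D w) →
      val K φ w ρ = true → val K φ v ρ = true := by
  induction φ with
  | atom p args =>
    intro w v ρ hwv hρ h
    simp only [val] at h ⊢
    have := K.hered hwv p (fun i => ρ (args i)) (fun i => hρ _)
    rw [h] at this
    exact top_le_iff.mp this
  | conn c args ih =>
    intro w v ρ hwv hρ h
    simp only [val, decide_eq_true_eq] at h ⊢
    exact fun u hu => h u (K.le_trans hwv hu)
  | all x φ ih =>
    intro w v ρ hwv hρ h
    simp only [val, decide_eq_true_eq] at h ⊢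
    exact fun u hu => h u (K.le_trans hwv hu)
  | ex x φ ih =>
    intro w v ρ hwv hρ h
    simp only [val, decide_eq_true_eq] at h ⊢
    obtain ⟨a, ha, h⟩ := h
    refine ⟨a, K.D_mono hwv ha, ih hwv (fun y => ?_) h⟩
    by_cases hy : y = x
    · subst hy; simpa using ha
    · simpa [hy] using hρ y

/-- A supermultiplicative function is closed under arbitrary nonempty meets. -/
theorem Supermultiplicative.iInf {n : ℕ} {f : (Fin n → Bool) → Bool}
    (hf : Supermultiplicative f) {ι : Type*} [Nonempty ι] (a : ι → Fin n → Bool)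
    (ha : ∀ j, f (a j) = true) (t : Fin n → Bool)
    (ht : ∀ i, t i = true ↔ ∀ j, a j i = true) : f t = true := by
  have key : ∀ s : Finset (Fin n), ∃ u : Fin n → Bool, f u = true ∧
      (∀ i, t i = true → u i = true) ∧ ∀ i ∈ s, u i = true → t i = true := by
    intro s
    induction s using Finset.induction_on with
    | empty =>
      obtain ⟨j⟩ := ‹Nonempty ι›
      exact ⟨a j, ha j, fun i hi => (ht i).1 hi j, by simp⟩
    | insert i s _ ih =>
      obtain ⟨u, hu, hut, hus⟩ := ih
      obtain ⟨j, hj⟩ : ∃ j, a j i = true → t i = true := by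
        by_contra! h
        obtain ⟨j⟩ := ‹Nonempty ι›
        exact (h j).2 ((ht i).2 fun j => (h j).1)
      refine ⟨_, hf u (a j) hu (ha j), fun k hk => ?_, fun k hk => ?_⟩
      · simp [hut k hk, (ht k).1 hk j]
      · simp only [Bool.and_eq_true]
        rintro ⟨h1, h2⟩
        rcases Finset.mem_insert.1 hk with rfl | hk
        · exact hj h2
        · exact hus k hk h1
  obtain ⟨u, hu, h1, h2⟩ := key Finset.univ
  have : u = t := funext fun i => Bool.eq_iff_iff.2 ⟨h2 i (Finset.mem_univ i), h1 i⟩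
  exact this ▸ hu

/-- Nodes of the tree unravelling in which every successor has continuum many copies;
the most recent step is the head of the list. -/
abbrev Node (W : Type) : Type := List (W × ℝ)

section Unravelling

variable {sig : Signature} {W U : Type} (K : Kripke sig W U) (r : W)

/-- The world reached at a node; steps to inaccessible worlds are ignored. -/
noncomputable def nodeWorld : Node W → W
  | [] => r
  | (v, _) :: l => if K.le (nodeWorld l) v then v else nodeWorld l

theorem nodeWorld_cons {l : Node W} {v : W} (h : K.le (nodeWorld K r l) v) (k : ℝ) :
    nodeWorld K r ((v, k) :: l) = v := by
  simp [nodeWorld, h]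

theorem nodeWorld_le_cons (s : W × ℝ) (l : Node W) :
    K.le (nodeWorld K r l) (nodeWorld K r (s :: l)) := by
  by_cases h : K.le (nodeWorld K r l) s.1
  · rwa [nodeWorld_cons K r h]
  · simpa [nodeWorld, h] using K.le_refl _

theorem nodeWorld_mono {l m : Node W} (h : l <:+ m) :
    K.le (nodeWorld K r l) (nodeWorld K r m) := by
  induction m with
  | nil => rw [List.suffix_nil.1 h]; exact K.le_refl _
  | cons s m ih =>
    rcases List.suffix_cons_iff.1 h with rfl | h
    · exact K.le_refl _
    · exact K.le_trans (ih h) (nodeWorld_le_cons K r s m)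

/-- `f` keeps its value at `l` throughout the cone above the child `(v, k)` of `l`. -/
def ConstAbove {α : Type*} (f : Node W → α) (l : Node W) (v : W) (k : ℝ) : Prop :=
  ∀ m, (v, k) :: l <:+ m → f m = f l

/-- The individuals of the unravelling: choices of an individual at each node that stay
constant above all but countably many copies of each child. -/
def choiceDomain : Set (Node W → U) :=
  {f | (∀ l, f l ∈ K.D (nodeWorld K r l)) ∧
    ∀ l v, {k | ¬ ConstAbove f l v k}.Countable}

theorem countable_cons_suffix (l n : Node W) (v : W) :
    {k : ℝ | (v, k) :: l <:+ n}.Countable := by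
  refine Set.Subsingleton.countable fun k hk k' hk' => ?_
  have := List.suffix_of_suffix_length_le hk hk' (by simp)
  have := this.eq_of_length (by simp)
  simpa using this

theorem ite_mem_choiceDomain (n : Node W) {a d : U} (ha : a ∈ K.D (nodeWorld K r n))
    (hd : d ∈ K.D r) :
    (fun m => if n <:+ m then a else d) ∈ choiceDomain K r := by
  refine ⟨fun l => ?_, fun l v => ?_⟩
  · dsimp only
    split_ifs with h
    · exact K.D_mono (nodeWorld_mono K r h) ha
    · exact K.D_mono (nodeWorld_mono K r (List.nil_suffix)) hd
  · refine (countable_cons_suffix l n v).mono fun k hk => ?_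
    by_contra hkn
    refine hk fun m hm => ?_
    have : n <:+ m ↔ n <:+ l := by
      refine ⟨fun h => ?_, fun h => (h.trans (List.suffix_cons _ _)).trans hm⟩
      rcases List.suffix_or_suffix_of_suffix h hm with h | h
      · rcases List.suffix_cons_iff.1 h with rfl | h
        · exact absurd List.suffix_rfl hkn
        · exact h
      · exact absurd h hkn
    simp only [this]

theorem const_mem_choiceDomain {d : U} (hd : d ∈ K.D r) :
    (fun _ => d) ∈ choiceDomain K r := by
  simpa using ite_mem_choiceDomain K r [] hd hd

/-- The constant domain unravelling: truth of an atom at a node is truth at all nodes above. -/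
noncomputable def unravelling : Kripke sig (Node W) (Node W → U) where
  le l m := l <:+ m
  le_refl _ := List.suffix_rfl
  le_trans := List.IsSuffix.trans
  D _ := choiceDomain K r
  D_nonempty _ := (K.D_nonempty r).elim fun _ hd => ⟨_, const_mem_choiceDomain K r hd⟩
  D_mono _ := subset_rfl
  I l p a := decide (∀ m, l <:+ m → K.I (nodeWorld K r m) p (fun i => a i m) = true)
  hered h p a _ := by
    rw [Bool.le_iff_imp]
    simp only [decide_eq_true_eq]
    exact fun H m hm => H m (h.trans hm)

theorem exists_constAbove {ρ : ℕ → Node W → U} (hρ : ∀ x, ρ x ∈ choiceDomain K r)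
    (l : Node W) (v : W) : ∃ k, ∀ x, ConstAbove (ρ x) l v k := by
  have hc : (⋃ x, {k | ¬ ConstAbove (ρ x) l v k}).Countable :=
    Set.countable_iUnion fun x => (hρ x).2 l v
  by_contra! h
  refine Set.not_countable_univ (α := ℝ) (hc.mono fun k _ => ?_)
  simpa using h k

/-- Follow `h`, but keep the previous value when stepping into a cone where `ρ` is constant
and which does not contain `n`. -/
noncomputable def persist (ρ : ℕ → Node W → U) (n : Node W) (h : Node W → U) : Node W → U
  | [] => h []
  | (v, k) :: l =>
    if (∀ x, ConstAbove (ρ x) l v k) ∧ ¬ (v, k) :: l <:+ n then persist ρ n h l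
    else h ((v, k) :: l)

theorem countable_not_constAbove_persist {ρ : ℕ → Node W → U}
    (hρ : ∀ x, ρ x ∈ choiceDomain K r) (n : Node W) (h : Node W → U) (l : Node W) (v : W) :
    {k | ¬ ConstAbove (persist ρ n h) l v k}.Countable := by
  have hc : ((⋃ x, {k | ¬ ConstAbove (ρ x) l v k}) ∪ {k : ℝ | (v, k) :: l <:+ n}).Countable :=
    (Set.countable_iUnion fun x => (hρ x).2 l v).union (countable_cons_suffix l n v)
  refine hc.mono fun k hk => ?_
  by_contra hkn
  simp only [Set.mem_union, Set.mem_iUnion, Set.mem_ofPred_eq, not_or, not_exists, not_not] at hkn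
  obtain ⟨h1, h2⟩ := hkn
  refine hk fun m hm => ?_
  induction m with
  | nil => simp at hm
  | cons s m ih =>
    obtain ⟨v', k'⟩ := s
    rcases List.suffix_cons_iff.1 hm with he | hm'
    · obtain ⟨⟨rfl, rfl⟩, rfl⟩ : (v = v' ∧ k = k') ∧ l = m := by simpa using he
      rw [persist, if_pos ⟨h1, h2⟩]
    · rw [persist, if_pos, ih hm']
      refine ⟨fun x q hq => ?_, fun hq => h2 (hm.trans hq)⟩
      rw [h1 x q (hm.trans hq), h1 x m hm']

theorem update_apply_node (ρ : ℕ → Node W → U) (x : ℕ) (f : Node W → U) (m : Node W) :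
    (fun y => Function.update ρ x f y m) = Function.update (fun y => ρ y m) x (f m) := by
  funext y
  by_cases hy : y = x
  · subst hy; simp
  · simp [hy]

theorem update_mem {α : Type*} {D : Set α} {ρ : ℕ → α} (hρ : ∀ x, ρ x ∈ D) (x : ℕ) {a : α}
    (ha : a ∈ D) (y : ℕ) : Function.update ρ x a y ∈ D := by
  by_cases hy : y = x
  · subst hy; simpa using ha
  · simpa [hy] using hρ y

theorem exists_choice_witness {ρ : ℕ → Node W → U} (hρ : ∀ x, ρ x ∈ choiceDomain K r)
    (n : Node W) (x : ℕ) (φ : Formula sig)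
    (H : ∀ m, n <:+ m → ∃ a ∈ K.D (nodeWorld K r m),
      val K φ (nodeWorld K r m) (Function.update (fun y => ρ y m) x a) = true) :
    ∃ f ∈ choiceDomain K r, ∀ m, n <:+ m →
      val K φ (nodeWorld K r m) (Function.update (fun y => ρ y m) x (f m)) = true := by
  have H' : ∀ m, ∃ a ∈ K.D (nodeWorld K r m), n <:+ m →
      val K φ (nodeWorld K r m) (Function.update (fun y => ρ y m) x a) = true := by
    intro m
    by_cases hm : n <:+ m
    · obtain ⟨a, ha, h⟩ := H m hm
      exact ⟨a, ha, fun _ => h⟩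
    · obtain ⟨d, hd⟩ := K.D_nonempty (nodeWorld K r m)
      exact ⟨d, hd, fun h => absurd h hm⟩
  choose h hD hval using H'
  have key : ∀ m, persist ρ n h m ∈ K.D (nodeWorld K r m) ∧ (n <:+ m →
      val K φ (nodeWorld K r m)
        (Function.update (fun y => ρ y m) x (persist ρ n h m)) = true) := by
    intro m
    induction m with
    | nil => exact ⟨hD [], hval []⟩
    | cons s m ih =>
      obtain ⟨v, k⟩ := s
      rw [persist]
      split_ifs with hk
      · have hle := nodeWorld_le_cons K r (v, k) m
        refine ⟨K.D_mono hle ih.1, fun hn => ?_⟩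
        have hn' : n <:+ m := by
          rcases List.suffix_cons_iff.1 hn with rfl | hn
          · exact absurd List.suffix_rfl hk.2
          · exact hn
        have heq : (fun y => ρ y ((v, k) :: m)) = fun y => ρ y m :=
          funext fun y => hk.1 y _ List.suffix_rfl
        rw [heq]
        exact val_mono K φ hle (update_mem (fun y => (hρ y).1 m) x ih.1) (ih.2 hn')
      · exact ⟨hD _, hval _⟩
  exact ⟨persist ρ n h, ⟨fun m => (key m).1, countable_not_constAbove_persist K r hρ n h⟩,
    fun m => (key m).2⟩

/-- Truth in the unravelling is truth at all nodes above. -/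
theorem val_unravelling (hsm : ∀ c : sig.Conn, Supermultiplicative (sig.tt c))
    (φ : Formula sig) : ∀ (l : Node W) (ρ : ℕ → Node W → U), (∀ x, ρ x ∈ choiceDomain K r) →
      (val (unravelling K r) φ l ρ = true ↔
        ∀ m, l <:+ m → val K φ (nodeWorld K r m) (fun x => ρ x m) = true) := by
  induction φ with
  | atom p args =>
    intro l ρ hρ
    simp only [val, unravelling, decide_eq_true_eq]
  | conn c args ih =>
    intro l ρ hρ
    simp only [val, decide_eq_true_eq]
    constructor
    · intro H m hm v hv
      obtain ⟨k, hk⟩ := exists_constAbove K r hρ m v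
      have hw := nodeWorld_cons K r hv k
      rw [← H ((v, k) :: m) (hm.trans (List.suffix_cons _ _))]
      congr 1
      funext i
      rw [Bool.eq_iff_iff, ih i _ ρ hρ]
      constructor
      · intro h q hq
        have heq : (fun x => ρ x q) = fun x => ρ x m := funext fun x => hk x q hq
        have hle := nodeWorld_mono K r hq
        rw [hw] at hle
        rw [heq]
        exact val_mono K _ hle (fun x => K.D_mono hv ((hρ x).1 m)) h
      · intro h
        have h := h _ List.suffix_rfl
        have heq : (fun x => ρ x ((v, k) :: m)) = fun x => ρ x m :=
          funext fun x => hk x _ List.suffix_rfl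
        rwa [heq, hw] at h
    · intro H m hm
      have : Nonempty {q : Node W // m <:+ q} := ⟨⟨m, List.suffix_rfl⟩⟩
      refine (hsm c).iInf
        (fun (q : {q : Node W // m <:+ q}) i =>
          val K (args i) (nodeWorld K r q) (fun x => ρ x q))
        (fun q => H q (List.IsSuffix.trans hm q.2) _ (K.le_refl _)) _ fun i => ?_
      rw [ih i m ρ hρ]
      exact ⟨fun h q => h q q.2, fun h q hq => h ⟨q, hq⟩⟩
  | all x φ ih =>
    intro l ρ hρ
    simp only [val, decide_eq_true_eq]
    constructor
    · intro H m hm v hv a ha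
      obtain ⟨k, hk⟩ := exists_constAbove K r hρ m v
      have hw := nodeWorld_cons K r hv k
      obtain ⟨d, hd⟩ := K.D_nonempty r
      have hf := ite_mem_choiceDomain K r ((v, k) :: m) (by rwa [hw]) hd
      have h := H ((v, k) :: m) (hm.trans (List.suffix_cons _ _)) _ hf
      rw [ih _ _ (update_mem hρ x hf)] at h
      have h := h _ List.suffix_rfl
      have heq : (fun x => ρ x ((v, k) :: m)) = fun x => ρ x m :=
        funext fun x => hk x _ List.suffix_rfl
      rw [update_apply_node, hw, heq] at h
      simpa using h
    · intro H m hm f hf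
      rw [ih _ _ (update_mem hρ x hf)]
      intro q hq
      rw [update_apply_node]
      exact H q (List.IsSuffix.trans hm hq) _ (K.le_refl _) _ (hf.1 q)
  | ex x φ ih =>
    intro l ρ hρ
    simp only [val, decide_eq_true_eq]
    constructor
    · rintro ⟨f, hf, h⟩ m hm
      rw [ih _ _ (update_mem hρ x hf)] at h
      have h := h m hm
      rw [update_apply_node] at h
      exact ⟨f m, hf.1 m, h⟩
    · intro H
      obtain ⟨f, hf, h⟩ := exists_choice_witness K r hρ l x φ H
      refine ⟨f, hf, ?_⟩
      rw [ih _ _ (update_mem hρ x hf)]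
      intro m hm
      rw [update_apply_node]
      exact h m hm

end Unravelling

theorem FOILS_of_FOCDS {sig : Signature} (hsm : ∀ c : sig.Conn, Supermultiplicative (sig.tt c))
    {Γ : Set (Formula sig)} {δ : Formula sig} (h : FOCDS sig Γ {δ}) : FOILS sig Γ {δ} := by
  intro W U K w ρ hρ ⟨hΓ, hδ⟩
  have hρ' : ∀ x, (fun _ => ρ x) ∈ choiceDomain K w :=
    fun x => const_mem_choiceDomain K w (hρ x)
  refine h (Node W) (Node W → U) (unravelling K w) (fun _ _ => rfl) [] (fun x _ => ρ x) hρ'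
    ⟨fun φ hφ => ?_, ?_⟩
  · rw [val_unravelling K w hsm φ [] _ hρ']
    exact fun m hm => val_mono K φ (nodeWorld_mono K w hm) hρ (hΓ φ hφ)
  · intro φ hφ
    rw [hφ, ← Bool.not_eq_true, val_unravelling K w hsm _ [] _ hρ']
    intro H
    have h1 : val K δ w ρ = true := H [] List.suffix_rfl
    rw [hδ δ rfl] at h1
    exact absurd h1 (by decide)

section Separation

/-- Combine four values according to the four joint patterns of `a` and `b`. -/
def pattern {α : Type*} {n : ℕ} (a b : Fin n → Bool) (t p q o : α) (i : Fin n) : α :=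
  if a i then (if b i then t else p) else if b i then q else o

theorem apply_pattern {α β : Type*} {n : ℕ} (g : α → β) (a b : Fin n → Bool) (t p q o : α) :
    (fun i => g (pattern a b t p q o i)) = pattern a b (g t) (g p) (g q) (g o) := by
  funext i
  simp only [pattern]
  split_ifs <;> rfl

theorem pattern_left {n : ℕ} (a b : Fin n → Bool) : pattern a b true true false false = a := by
  funext i; cases h : a i <;> cases h' : b i <;> simp [pattern, h, h']

theorem pattern_right {n : ℕ} (a b : Fin n → Bool) : pattern a b true false true false = b := by
  funext i; cases h : a i <;> cases h' : b i <;> simp [pattern, h, h']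

theorem pattern_inf {n : ℕ} (a b : Fin n → Bool) :
    pattern a b true false false false = fun i => a i && b i := by
  funext i; cases h : a i <;> cases h' : b i <;> simp [pattern, h, h']

variable (sig : Signature)

/-- A propositional atom. -/
def atomT : Formula sig := .atom (0, 0) (fun _ => 0)

/-- The atom `P(x₀)`. -/
def atomP : Formula sig := .atom (0, 1) (fun _ => 0)

/-- The formula `∃x₁ S(x₀, x₁)`. -/
def exS : Formula sig := .ex 1 (.atom (0, 2) (fun i => i.val))

/-- The formula `∃x₀ S(x₀, x₀)`. -/
def diagS : Formula sig := .ex 0 (.atom (0, 2) (fun _ => 0))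

/-- The two-world model with growing domain `{false} ⊆ {false, true}` in which `P` holds of
`false` and `S` holds of `(true, false)`. -/
def growingModel : Kripke sig Bool Bool where
  le w v := w ≤ v
  le_refl _ := le_rfl
  le_trans := le_trans
  D w := {a | a ≤ w}
  D_nonempty w := ⟨w, le_refl w⟩
  D_mono h _ ha := le_trans ha h
  I _ p a := match p, a with
    | (_, 0), _ => true
    | (_, 1), a => !a 0
    | (_, _ + 2), a => a 0 && !a 1
  hered _ _ _ _ := le_rfl

variable {sig}

theorem growingModel_atomT (w : Bool) (ρ : ℕ → Bool) :
    val (growingModel sig) (atomT sig) w ρ = true := rfl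

theorem growingModel_atomP (w : Bool) (ρ : ℕ → Bool) :
    val (growingModel sig) (atomP sig) w ρ = !ρ 0 := rfl

theorem growingModel_allP (w : Bool) (ρ : ℕ → Bool) :
    val (growingModel sig) (.all 0 (atomP sig)) w ρ = false := by
  simp only [val, decide_eq_false_iff_not]
  intro h
  simpa [growingModel_atomP] using h true (Bool.le_true w) true (le_refl true)

theorem growingModel_exS (w : Bool) (ρ : ℕ → Bool) :
    val (growingModel sig) (exS sig) w ρ = ρ 0 := by
  rw [Bool.eq_iff_iff]
  simp [exS, val, growingModel]

theorem growingModel_exexS (w : Bool) (ρ : ℕ → Bool) :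
    val (growingModel sig) (.ex 0 (exS sig)) w ρ = w := by
  simp only [val, growingModel_exS]
  cases w <;> simp [growingModel]

theorem growingModel_diagS (w : Bool) (ρ : ℕ → Bool) :
    val (growingModel sig) (diagS sig) w ρ = false := by
  simp [diagS, val, growingModel]

theorem val_allP_of_forall {W U : Type} {K : Kripke sig W U} (hK : ConstantDomain K) {w : W}
    {ρ : ℕ → U} (h : ∀ a ∈ K.D w, val K (atomP sig) w (Function.update ρ 0 a) = true) :
    val K (.all 0 (atomP sig)) w ρ = true := by
  rw [val, decide_eq_true_eq]
  intro v hv a ha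
  rw [hK v w] at ha
  have h := h a ha
  simp only [atomP, val, Function.update_self] at h ⊢
  have := K.hered hv (0, 1) (fun _ => a) (fun _ => ha)
  rw [h] at this
  exact top_le_iff.mp this

theorem val_atomT_congr {W U : Type} (K : Kripke sig W U) (w : W) (ρ ρ' : ℕ → U) :
    val K (atomT sig) w ρ = val K (atomT sig) w ρ' := by
  rw [atomT, val, val]
  congr 1
  funext i
  exact i.elim0

theorem val_all {W U : Type} (K : Kripke sig W U) (x : ℕ) (φ : Formula sig) (w : W)
    (ρ : ℕ → U) : val K (.all x φ) w ρ = true ↔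
      ∀ v, K.le w v → ∀ a ∈ K.D v, val K φ v (Function.update ρ x a) = true := by
  rw [val, decide_eq_true_eq]

theorem val_conn_pattern {W U : Type} (K : Kripke sig W U) (c : sig.Conn)
    (a b : Fin (sig.arity c) → Bool) (t p q o : Formula sig) (w : W) (ρ : ℕ → U) :
    val K (.conn c (pattern a b t p q o)) w ρ = true ↔ ∀ v, K.le w v →
      sig.tt c (pattern a b (val K t v ρ) (val K p v ρ) (val K q v ρ) (val K o v ρ)) = true := by
  rw [val, decide_eq_true_eq]
  refine forall₂_congr fun v _ => ?_
  rw [← apply_pattern (fun φ => val K φ v ρ)]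

theorem FOCDS_conn_all (c : sig.Conn) (a b : Fin (sig.arity c) → Bool) :
    FOCDS sig {.all 0 (.conn c (pattern a b (atomT sig) (atomP sig) (.ex 0 (exS sig)) (diagS sig)))}
      {.conn c (pattern a b (atomT sig) (.all 0 (atomP sig)) (.ex 0 (exS sig)) (diagS sig))} := by
  intro W U K hK w ρ hρ ⟨hΓ, hδ⟩
  have h1 := hΓ _ rfl
  have h2 := hδ _ rfl
  rw [← Bool.not_eq_true, val_conn_pattern] at h2
  rw [val, decide_eq_true_eq] at h1
  refine h2 fun v hv => ?_
  obtain ⟨u, hu, he⟩ : ∃ u ∈ K.D v, val K (.all 0 (atomP sig)) v ρ =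
      val K (atomP sig) v (Function.update ρ 0 u) := by
    by_cases h : ∀ u ∈ K.D v, val K (atomP sig) v (Function.update ρ 0 u) = true
    · obtain ⟨u, hu⟩ := K.D_nonempty v
      exact ⟨u, hu, by rw [h u hu, val_allP_of_forall hK h]⟩
    · push Not at h
      obtain ⟨u, hu, h⟩ := h
      refine ⟨u, hu, ?_⟩
      rw [ne_eq, Bool.not_eq_true] at h
      rw [h, val, decide_eq_false_iff_not]
      intro H
      rw [H v (K.le_refl v) u hu] at h
      exact absurd h (by decide)
  have h3 := h1 v hv u hu
  rw [val_conn_pattern] at h3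
  have h3 := h3 v (K.le_refl v)
  rw [he, val_atomT_congr K v ρ (Function.update ρ 0 u)]
  simpa [val, exS, diagS] using h3

theorem FOCDS_exS (c : sig.Conn) (a b : Fin (sig.arity c) → Bool)
    (hab : sig.tt c (fun i => a i && b i) = false)
    (hxor : sig.tt c (pattern a b true true true false) = false) :
    FOCDS sig {atomT sig,
        .all 0 (.conn c (pattern a b (atomT sig) (atomP sig) (exS sig) (diagS sig))),
        .conn c (pattern a b (atomT sig) (.all 0 (atomP sig)) (atomT sig) (diagS sig))}
      {.ex 0 (exS sig)} := by
  intro W U K hK w ρ hρ ⟨hΓ, hδ⟩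
  have hT := hΓ _ (.inl rfl)
  have h1 := hΓ _ (.inr (.inl rfl))
  have h2 := hΓ _ (.inr (.inr rfl))
  have h0 := hδ _ rfl
  rw [val, decide_eq_false_iff_not] at h0
  push Not at h0
  rw [val, decide_eq_true_eq] at h1
  have hdiag : ∀ ρ' : ℕ → U, val K (diagS sig) w ρ' = false := by
    intro ρ'
    rw [diagS, val, decide_eq_false_iff_not]
    rintro ⟨u, hu, h⟩
    refine h0 u hu ?_
    rw [exS, val, decide_eq_true_eq]
    refine ⟨u, hu, ?_⟩
    rw [← h, val, val]
    congr 1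
    funext i
    fin_cases i <;> simp
  have hall : val K (.all 0 (atomP sig)) w ρ = true := by
    refine val_allP_of_forall hK fun u hu => ?_
    have h3 := h1 w (K.le_refl w) u hu
    rw [val_conn_pattern] at h3
    have h3 := h3 w (K.le_refl w)
    rw [val_atomT_congr K w _ ρ, hT, hdiag, Bool.eq_false_of_not_eq_true (h0 u hu)] at h3
    by_contra hP
    rw [Bool.not_eq_true] at hP
    rw [hP, pattern_inf, hab] at h3
    exact absurd h3 (by decide)
  rw [val_conn_pattern] at h2
  have h2 := h2 w (K.le_refl w)
  rw [hT, hall, hdiag, hxor] at h2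
  exact absurd h2 (by decide)

end Separation

theorem supermultiplicative_of_FOILS_of_FOCDS {sig : Signature}
    (H : ∀ (Γ : Set (Formula sig)) (δ : Formula sig), FOCDS sig Γ {δ} → FOILS sig Γ {δ})
    (c : sig.Conn) : Supermultiplicative (sig.tt c) := by
  intro a b ha hb
  by_contra hab
  rw [Bool.not_eq_true] at hab
  have hw : ∀ x, (fun _ : ℕ => false) x ∈ (growingModel sig).D false := fun _ => le_refl false
  cases hor : sig.tt c (pattern a b true true true false)
  · refine H _ _ (FOCDS_exS c a b hab hor) _ _ (growingModel sig) false _ hw ⟨?_, ?_⟩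
    · rintro _ (rfl | rfl | rfl)
      · rfl
      · rw [val_all]
        intro v _ u _
        rw [val_conn_pattern]
        intro v' _
        rw [growingModel_atomT, growingModel_atomP, growingModel_exS, growingModel_diagS]
        cases u
        · simpa [pattern_left] using ha
        · simpa [pattern_right] using hb
      · rw [val_conn_pattern]
        intro v _
        rw [growingModel_atomT, growingModel_allP, growingModel_diagS, pattern_right, hb]
    · rintro _ rfl
      exact growingModel_exexS _ _
  · refine H _ _ (FOCDS_conn_all c a b) _ _ (growingModel sig) false _ hw ⟨?_, ?_⟩
    · rintro _ rfl
      rw [val_all]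
      intro v _ u hu
      rw [val_conn_pattern]
      intro v' hv'
      rw [growingModel_atomT, growingModel_atomP, growingModel_exexS, growingModel_diagS]
      have huv : u ≤ v' := le_trans hu hv'
      cases u <;> cases v'
      · simpa [pattern_left] using ha
      · simpa using hor
      · exact absurd huv (by decide)
      · simpa [pattern_right] using hb
    · rintro _ rfl
      rw [← Bool.not_eq_true, val_conn_pattern]
      intro h
      have h := h false le_rfl
      rw [growingModel_atomT, growingModel_allP, growingModel_exexS, growingModel_diagS,
        pattern_inf, hab] at h
      exact absurd h (by decide)

/-- **single-succedent version of the main theorem.**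
`FOILS₁(C) = FOCDS₁(C)` — restricted to sequents whose succedent is a single
formula — if and only if every connective in `C` is supermultiplicative. -/
theorem FOILS1_eq_FOCDS1_iff_supermultiplicative (sig : Signature) :
    (∀ (Γ : Set (Formula sig)) (δ : Formula sig),
        FOILS sig Γ {δ} ↔ FOCDS sig Γ {δ}) ↔
      ∀ c : sig.Conn, Supermultiplicative (sig.tt c) := by
  refine ⟨fun H => supermultiplicative_of_FOILS_of_FOCDS fun Γ δ => (H Γ δ).2,
    fun hsm Γ δ => ⟨fun h W U K _ => h W U K, FOILS_of_FOCDS hsm⟩⟩
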